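/- Let φ be a W-linear endomorphism of N with matrix A = (a_{ij}) commuting with F, and let b ∈ k be such that 1, b, b² are linearly independent over the subfield 𝔽_{p²} = {x ∈ k : x^{p²} = x}. Then φ(M_b) ⊆ M_b if and only if ρ(a₁₃) = 0, ρ(a₃₁) = 0 and ρ(a₁₁) = ρ(a₃₃); moreover in this case the common value ρ(a₁₁) = ρ(a₃₃) lies in 𝔽_{p²}. -/

import Mathlib

/-!
Common setup: `p` a prime, `k` an algebraically closed field of characteristic `p`,
`W = W(k)` the ring of `p`-typical Witt vectors, `σ` the Witt vector Frobenius,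
`ρ : W → k` reduction (0-th coefficient), `N = W⁴` with the semilinear maps `F`, `V`,
the Gram matrix `J'` of the alternating form, the Dieudonné submodules `M_b`, and the
coordinate map `q` for `N/V(N)`.
-/

noncomputable section

open WittVector Matrix

variable (p : ℕ) [Fact p.Prime] (k : Type) [Field k] [IsAlgClosed k] [CharP k p]

/-- The reduction map `ρ : W(k) → k` sending a Witt vector to its 0-th coefficient. -/
def redW : WittVector p k →+* k where
  toFun x := x.coeff 0
  map_one' := WittVector.one_coeff_zero p k
  map_mul' := WittVector.mul_coeff_zero
  map_zero' := WittVector.zero_coeff p k 0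
  map_add' := WittVector.add_coeff_zero

/-- The Witt vector Frobenius `σ`, a ring automorphism of `W(k)` since `k` is perfect. -/
def sigmaW : WittVector p k ≃+* WittVector p k := WittVector.frobeniusEquiv p k

/-- The standard basis vectors `e₁, e₂, e₃, e₄` of `N = W⁴` (0-indexed). -/
def eW (i : Fin 4) : Fin 4 → WittVector p k := Pi.single i 1

/-- The `σ`-semilinear map `F : N → N` with `F e₁ = e₂`, `F e₂ = -p e₁`,
`F e₃ = e₄`, `F e₄ = -p e₃`. -/
def Fmap : (Fin 4 → WittVector p k) → (Fin 4 → WittVector p k) := fun x =>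
  ![-(p : WittVector p k) * sigmaW p k (x 1), sigmaW p k (x 0),
    -(p : WittVector p k) * sigmaW p k (x 3), sigmaW p k (x 2)]

/-- The `σ⁻¹`-semilinear map `V : N → N` with `V e₁ = -e₂`, `V e₂ = p e₁`,
`V e₃ = -e₄`, `V e₄ = p e₃`. -/
def Vmap : (Fin 4 → WittVector p k) → (Fin 4 → WittVector p k) := fun x =>
  ![(p : WittVector p k) * (sigmaW p k).symm (x 1), -(sigmaW p k).symm (x 0),
    (p : WittVector p k) * (sigmaW p k).symm (x 3), -(sigmaW p k).symm (x 2)]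

/-- The Gram matrix `J'` of the alternating form `⟨ , ⟩` on `N` with
`⟨e₁,e₃⟩ = 1 = -⟨e₃,e₁⟩`, `⟨e₂,e₄⟩ = p = -⟨e₄,e₂⟩`. -/
def Jmat : Matrix (Fin 4) (Fin 4) (WittVector p k) :=
  !![0, 0, 1, 0;
     0, 0, 0, (p : WittVector p k);
     -1, 0, 0, 0;
     0, -(p : WittVector p k), 0, 0]

/-- The `W`-linear endomorphism of `N` with matrix `A` commutes with `F`. -/
def CommF (A : Matrix (Fin 4) (Fin 4) (WittVector p k)) : Prop :=
  ∀ x, A.mulVec (Fmap p k x) = Fmap p k (A.mulVec x)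

/-- The `W`-submodule `M_b` of `N` spanned by `p e₁, p e₃, e₂, e₄` and `e₁ + b̃ e₃`,
where `b̃` is the Teichmüller lift of `b` (a lift of `b` under `ρ`). -/
def Mmod (b : k) : Submodule (WittVector p k) (Fin 4 → WittVector p k) :=
  Submodule.span (WittVector p k)
    {(p : WittVector p k) • eW p k 0, (p : WittVector p k) • eW p k 2, eW p k 1, eW p k 3,
     eW p k 0 + WittVector.teichmuller p b • eW p k 2}

/-- Coordinates of the class of `x ∈ N` in `N/V(N) ≃ k²` with respect to the basis given
by the classes of `e₁` and `e₃`. -/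
def qmap : (Fin 4 → WittVector p k) → (Fin 2 → k) := fun x => ![redW p k (x 0), redW p k (x 2)]

lemma redW_sigmaW (x : WittVector p k) : redW p k (sigmaW p k x) = redW p k x ^ p :=
  WittVector.coeff_frobenius_charP p x 0

lemma exists_eq_prime_mul_of_redW_eq_zero {x : WittVector p k} (hx : redW p k x = 0) :
    ∃ y, x = (p : WittVector p k) * y :=
  (WittVector.mem_span_p_iff_coeff_zero_eq_zero x).2 hx |> Ideal.mem_span_singleton.1

/-- Membership in `M_b` only depends on the reductions of the first and third coordinates. -/
lemma mem_Mmod_iff (b : k) (x : Fin 4 → WittVector p k) :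
    x ∈ Mmod p k b ↔ redW p k (x 2) = b * redW p k (x 0) := by
  have hb : redW p k (WittVector.teichmuller p b) = b := WittVector.teichmuller_coeff_zero p b
  constructor
  · intro hx
    induction hx using Submodule.span_induction with
    | mem y hy =>
      simp only [Set.mem_insert_iff, Set.mem_singleton_iff] at hy
      rcases hy with rfl | rfl | rfl | rfl | rfl <;> simp [eW, hb]
    | zero => simp
    | add y z _ _ hy hz => simp only [Pi.add_apply, map_add, hy, hz, mul_add]
    | smul c y _ hy => simp only [Pi.smul_apply, smul_eq_mul, map_mul, hy, mul_left_comm]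
  · intro hx
    obtain ⟨y, hy⟩ := exists_eq_prime_mul_of_redW_eq_zero p k
      (x := x 2 - WittVector.teichmuller p b * x 0) (by rw [map_sub, map_mul, hb, hx, sub_self])
    have hdecomp : x = y • ((p : WittVector p k) • eW p k 2) + x 1 • eW p k 1 + x 3 • eW p k 3 +
        x 0 • (eW p k 0 + WittVector.teichmuller p b • eW p k 2) := by
      ext1 i
      fin_cases i <;> simp [eW]
      linear_combination hy
    rw [hdecomp]
    refine add_mem (add_mem (add_mem ?_ ?_) ?_) ?_ <;>
      exact Submodule.smul_mem _ _ (Submodule.subset_span (by simp))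

/-- Columns of a matrix commuting with `F`, in the form `A (F e_j) = F (A e_j)`. -/
lemma CommF.mulVec_Fmap_eW {A : Matrix (Fin 4) (Fin 4) (WittVector p k)} (hF : CommF p k A)
    (i j : Fin 4) : A.mulVec (Fmap p k (eW p k j)) i = Fmap p k (fun l => A l j) i := by
  rw [hF, eW, Matrix.mulVec_single_one]
  rfl

lemma CommF.redW_eq_zero {A : Matrix (Fin 4) (Fin 4) (WittVector p k)} (hF : CommF p k A) :
    redW p k (A 0 1) = 0 ∧ redW p k (A 0 3) = 0 ∧ redW p k (A 2 1) = 0 ∧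
      redW p k (A 2 3) = 0 := by
  have h := fun i j => congrArg (redW p k) (CommF.mulVec_Fmap_eW p k hF i j)
  refine ⟨?_, ?_, ?_, ?_⟩
  · simpa [Fmap, eW, Matrix.mulVec, dotProduct, Fin.sum_univ_four] using h 0 0
  · simpa [Fmap, eW, Matrix.mulVec, dotProduct, Fin.sum_univ_four] using h 0 2
  · simpa [Fmap, eW, Matrix.mulVec, dotProduct, Fin.sum_univ_four] using h 2 0
  · simpa [Fmap, eW, Matrix.mulVec, dotProduct, Fin.sum_univ_four] using h 2 2

lemma CommF.sigmaW_sigmaW {A : Matrix (Fin 4) (Fin 4) (WittVector p k)} (hF : CommF p k A) :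
    sigmaW p k (sigmaW p k (A 0 0)) = A 0 0 ∧ sigmaW p k (sigmaW p k (A 0 2)) = A 0 2 ∧
      sigmaW p k (sigmaW p k (A 2 0)) = A 2 0 ∧ sigmaW p k (sigmaW p k (A 2 2)) = A 2 2 := by
  have hp : (p : WittVector p k) ≠ 0 := WittVector.p_nonzero p k
  have h := CommF.mulVec_Fmap_eW p k hF
  have h10 := h 1 0
  have h12 := h 1 2
  have h30 := h 3 0
  have h32 := h 3 2
  have h01 := h 0 1
  have h03 := h 0 3
  have h21 := h 2 1
  have h23 := h 2 3
  simp [Fmap, eW, Matrix.mulVec, dotProduct, Fin.sum_univ_four] at h10 h12 h30 h32 h01 h03 h21 h23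
  rw [← h10, ← h12, ← h30, ← h32]
  refine ⟨?_, ?_, ?_, ?_⟩ <;> apply mul_left_cancel₀ hp
  · linear_combination -h01
  · linear_combination -h03
  · linear_combination -h21
  · linear_combination -h23

lemma redW_pow_of_sigmaW_sigmaW {x : WittVector p k} (hx : sigmaW p k (sigmaW p k x) = x) :
    redW p k x ^ p ^ 2 = redW p k x := by
  conv_rhs => rw [← hx]
  rw [redW_sigmaW, redW_sigmaW, ← pow_mul, sq]

/-- `M_b` is stable under `A` iff the reduced entries of `A` satisfy one quadratic relation. -/
lemma CommF.mapsTo_Mmod_iff {A : Matrix (Fin 4) (Fin 4) (WittVector p k)} (hF : CommF p k A)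
    (b : k) : (∀ x ∈ Mmod p k b, A.mulVec x ∈ Mmod p k b) ↔
      redW p k (A 2 0) + redW p k (A 2 2) * b =
        b * (redW p k (A 0 0) + redW p k (A 0 2) * b) := by
  obtain ⟨h01, h03, h21, h23⟩ := CommF.redW_eq_zero p k hF
  simp only [mem_Mmod_iff, Matrix.mulVec, dotProduct, Fin.sum_univ_four, map_add, map_mul,
    h01, h03, h21, h23, zero_mul, add_zero]
  constructor
  · intro h
    simpa [redW, WittVector.teichmuller_coeff_zero] using
      h ![1, 0, WittVector.teichmuller p b, 0]
        (by simp [redW, WittVector.teichmuller_coeff_zero])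
  · intro h x hx
    rw [hx]
    linear_combination redW p k (x 0) * h

/-- for `φ` commuting with `F` and `1, b, b²` linearly independent over
`𝔽_{p²}`, `φ(M_b) ⊆ M_b` iff `ρ(a₁₃) = 0`, `ρ(a₃₁) = 0` and `ρ(a₁₁) = ρ(a₃₃)`; moreover
in this case the common value lies in `𝔽_{p²}`. -/
theorem mapsTo_Mb_iff_generic
    (A : Matrix (Fin 4) (Fin 4) (WittVector p k)) (hF : CommF p k A)
    (b : k)
    (hb : ∀ t₀ t₁ t₂ : k, t₀ ^ p ^ 2 = t₀ → t₁ ^ p ^ 2 = t₁ → t₂ ^ p ^ 2 = t₂ →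
      t₀ + t₁ * b + t₂ * b ^ 2 = 0 → t₀ = 0 ∧ t₁ = 0 ∧ t₂ = 0) :
    ((∀ x ∈ Mmod p k b, A.mulVec x ∈ Mmod p k b) ↔
      (redW p k (A 0 2) = 0 ∧ redW p k (A 2 0) = 0 ∧
        redW p k (A 0 0) = redW p k (A 2 2))) ∧
    ((∀ x ∈ Mmod p k b, A.mulVec x ∈ Mmod p k b) →
      redW p k (A 0 0) ^ p ^ 2 = redW p k (A 0 0)) := by
  obtain ⟨h00, h02, h20, h22⟩ := CommF.sigmaW_sigmaW p k hF
  have hα := redW_pow_of_sigmaW_sigmaW p k h00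
  have hβ := redW_pow_of_sigmaW_sigmaW p k h02
  have hγ := redW_pow_of_sigmaW_sigmaW p k h20
  have hδ := redW_pow_of_sigmaW_sigmaW p k h22
  refine ⟨?_, fun _ => hα⟩
  rw [CommF.mapsTo_Mmod_iff p k hF b]
  constructor
  · intro h
    obtain ⟨hγ0, hαδ, hβ0⟩ := hb (redW p k (A 2 0)) (redW p k (A 2 2) - redW p k (A 0 0))
      (0 - redW p k (A 0 2)) hγ (by rw [sub_pow_char_pow, hα, hδ])
      (by rw [sub_pow_char_pow, hβ, zero_pow (pow_ne_zero 2 (Fact.out : p.Prime).ne_zero)])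
      (by linear_combination h)
    exact ⟨by linear_combination -hβ0, hγ0, by linear_combination -hαδ⟩
  · rintro ⟨hβ0, hγ0, hαδ⟩
    rw [hβ0, hγ0, hαδ]
    ring

end
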